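/- Let L' be a first-order language with no relation symbols and M an L'-structure. Let F be the substructure of the pointwise L'-structure on (M → M) generated by the identity function id : M → M. Then F is free on the single generator id over the class of algebras embeddable into powers of M: for every type Y, every substructure N of the pointwise L'-structure on (Y → M), and every element n ∈ N, there exists a unique L'-homomorphism h : F → N with h(id) = n. -/

import Mathlib

open FirstOrder Language Structure

universe u v

/-- The pointwise `L`-structure on a function type `X → M`. -/
instance piStructure {L : FirstOrder.Language} {X M : Type*} [L.Structure M] :
    L.Structure (X → M) where
  funMap f v x := funMap f fun i => v i x
  RelMap r v := ∀ x, RelMap r fun i => v i x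

/-- Precomposition with `g : Y → X`, as a homomorphism between powers of `M`. -/
def precompHom (L : FirstOrder.Language) (M : Type*) [L.Structure M] {X Y : Type*} (g : Y → X) :
    (X → M) →[L] (Y → M) where
  toFun f := f ∘ g
  map_fun' _ _ := rfl
  map_rel' _ _ h y := h (g y)

/-- Precomposition with a member of a substructure `N` of a power of `M` maps the substructure of
`M → M` generated by the identity into `N`. -/
theorem precompHom_mem {L : FirstOrder.Language} {M Y : Type*} [L.Structure M]
    {N : L.Substructure (Y → M)} {n : Y → M} (hn : n ∈ N) {f : M → M}
    (hf : f ∈ Substructure.closure L ({id} : Set (M → M))) : precompHom L M n f ∈ N := by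
  have hle : Substructure.closure L ({id} : Set (M → M)) ≤ N.comap (precompHom L M n) :=
    Substructure.closure_le.2 (Set.singleton_subset_iff.2 hn)
  exact hle hf

/-- Homomorphisms out of a generated substructure are determined by their values on the
generators. -/
theorem hom_closure_ext {L : FirstOrder.Language} {A B : Type*} [L.Structure A] [L.Structure B]
    {s : Set A} {g h : Substructure.closure L s →[L] B}
    (hs : ∀ x (hx : x ∈ s),
      g ⟨x, Substructure.subset_closure hx⟩ = h ⟨x, Substructure.subset_closure hx⟩) :
    g = h := by
  ext ⟨x, hx⟩
  induction hx using Substructure.closure_induction' with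
  | Hs x hx => exact hs x hx
  | Hfun f =>
    intro v hmem
    choose hv ih using hmem
    refine ⟨Substructure.fun_mem _ f v hv, ?_⟩
    have key : ∀ k : Substructure.closure L s →[L] B,
        k (funMap f fun i => ⟨v i, hv i⟩) = funMap f fun i => k ⟨v i, hv i⟩ :=
      fun k => k.map_fun f _
    exact (key g).trans ((congrArg (funMap f) (funext ih)).trans (key h).symm)

/-- the substructure of `M → M` generated by the identity function is
free on the generator `id` over the class of substructures of powers of `M`: for every
type `Y`, every substructure `N` of `Y → M` and every `n ∈ N` there is a unique
homomorphism from it to `N` sending `id` to `n`. -/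
theorem stmt16 {L : FirstOrder.Language} [L.IsAlgebraic] {M : Type v} [L.Structure M] :
    ∀ (Y : Type u) (N : L.Substructure (Y → M)) (n : N),
      ∃! h : (Substructure.closure L ({id} : Set (M → M))) →[L] N,
        h ⟨id, Substructure.subset_closure (Set.mem_singleton _)⟩ = n := by
  intro Y N n
  refine ⟨((precompHom L M (n : Y → M)).domRestrict _).codRestrict N
    fun f => precompHom_mem n.2 f.2, rfl, fun h hh => hom_closure_ext fun x hx => ?_⟩
  obtain rfl := Set.mem_singleton_iff.1 hx
  exact hh
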